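/- Let H be a densely defined operator on L²(ℝ) with domain invariant under translations such that for all c ∈ ℝ, T_c H T_{-c} = H − ic, where (T_cψ)(x) = ψ(x+c). If H has compact resolvent, then the spectrum of H is empty. -/

import Mathlib

open MeasureTheory

noncomputable section

/-- The translation operator `(T_c ψ)(x) = ψ(x + c)` on `L²(ℝ)`, as a linear isometry. -/
def translationLp (c : ℝ) :
    Lp ℂ 2 (volume : Measure ℝ) →ₗᵢ[ℂ] Lp ℂ 2 (volume : Measure ℝ) :=
  Lp.compMeasurePreservingₗᵢ ℂ (fun x => x + c) (measurePreserving_add_right volume c)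

/-- `R : E →L[ℂ] E` is the bounded, everywhere defined, two-sided inverse of `H - z`. -/
def IsResolventAt {E : Type*} [NormedAddCommGroup E] [InnerProductSpace ℂ E]
    (H : E →ₗ.[ℂ] E) (z : ℂ) (R : E →L[ℂ] E) : Prop :=
  (∀ ψ : H.domain, R (H ψ - z • (ψ : E)) = (ψ : E)) ∧
  ∀ φ : E, ∃ hφ : R φ ∈ H.domain, H ⟨R φ, hφ⟩ - z • R φ = φ

/-- The spectrum of a (possibly unbounded) operator. -/
def pmapSpectrum {E : Type*} [NormedAddCommGroup E] [InnerProductSpace ℂ E]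
    (H : E →ₗ.[ℂ] E) : Set ℂ :=
  {z | ¬∃ R : E →L[ℂ] E, IsResolventAt H z R}

/-- The eigenvalues of a compact operator do not accumulate away from zero. -/
theorem IsCompactOperator.not_injective_of_hasEigenvalue_of_le_norm
    {𝕜 X : Type*} [NontriviallyNormedField 𝕜] [CompleteSpace 𝕜]
    [NormedAddCommGroup X] [NormedSpace 𝕜 X] {T : X →L[𝕜] X} (hT : IsCompactOperator T)
    {μ : ℕ → 𝕜} (heig : ∀ n, Module.End.HasEigenvalue (T : Module.End 𝕜 X) (μ n))
    {δ : ℝ} (hδ : 0 < δ) (hμ : ∀ n, δ ≤ ‖μ n‖) : ¬ Function.Injective μ := by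
  intro hinj
  choose e he using fun n => (heig n).exists_hasEigenvector
  have hTe (n : ℕ) : T (e n) = μ n • e n := (he n).apply_eq_smul
  have hli : LinearIndependent 𝕜 e :=
    Module.End.eigenvectors_linearIndependent' (T : Module.End 𝕜 X) μ hinj e he
  let V (n : ℕ) : Submodule 𝕜 X := Submodule.span 𝕜 (e '' Set.Iio n)
  have hVmono : Monotone V := fun m n h =>
    Submodule.span_mono (Set.image_mono (Set.Iio_subset_Iio h))
  have hVclosed (n : ℕ) : IsClosed (V n : Set X) := by
    have : FiniteDimensional 𝕜 (V n) :=
      FiniteDimensional.span_of_finite 𝕜 ((Set.finite_Iio n).image e)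
    exact (V n).closed_of_finiteDimensional
  have heV (n : ℕ) : e n ∈ V (n + 1) :=
    Submodule.subset_span ⟨n, by simp, rfl⟩
  have heV' (n : ℕ) : e n ∉ V n := hli.notMem_span_image (by simp)
  have hTV (n : ℕ) : ∀ x ∈ V n, T x ∈ V n := by
    intro x hx
    induction hx using Submodule.span_induction with
    | mem x hx =>
      obtain ⟨k, hk, rfl⟩ := hx
      rw [hTe]
      exact Submodule.smul_mem _ _ (Submodule.subset_span ⟨k, hk, rfl⟩)
    | zero => simp
    | add x y _ _ hx hy => rw [map_add]; exact Submodule.add_mem _ hx hy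
    | smul a x _ hx => rw [map_smul]; exact Submodule.smul_mem _ _ hx
  have hSV (n : ℕ) : ∀ x ∈ V (n + 1), T x - μ n • x ∈ V n := by
    intro x hx
    induction hx using Submodule.span_induction with
    | mem x hx =>
      obtain ⟨k, hk, rfl⟩ := hx
      rw [hTe, ← sub_smul]
      rcases (Nat.lt_succ_iff.mp hk).lt_or_eq with h | rfl
      · exact Submodule.smul_mem _ _ (Submodule.subset_span ⟨k, h, rfl⟩)
      · simp
    | zero => simp
    | add x y _ _ hx hy =>
      convert Submodule.add_mem _ hx hy using 1
      rw [map_add]; module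
    | smul a x _ hx =>
      convert Submodule.smul_mem _ a hx using 1
      rw [map_smul]; module
  obtain ⟨c, hc⟩ := NormedField.exists_one_lt_norm 𝕜
  have hf (n : ℕ) : ∃ x ∈ V (n + 1), ‖x‖ ≤ ‖c‖ + 1 ∧ ∀ y ∈ V n, 1 ≤ ‖x - y‖ := by
    have hcl : IsClosed ((V n).comap (V (n + 1)).subtype : Set (V (n + 1))) :=
      (hVclosed n).preimage continuous_subtype_val
    obtain ⟨⟨x, hx⟩, hxn, hxy⟩ := riesz_lemma_of_norm_lt hc (lt_add_one ‖c‖) hcl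
      ⟨⟨e n, heV n⟩, heV' n⟩
    exact ⟨x, hx, hxn, fun y hy => hxy ⟨y, hVmono n.le_succ hy⟩ hy⟩
  choose f hfV hfn hfy using hf
  have hfar {m n : ℕ} (hmn : m < n) : δ ≤ ‖T (f n) - T (f m)‖ := by
    have hμn : μ n ≠ 0 := norm_pos_iff.mp (hδ.trans_le (hμ n))
    let u : X := (μ n)⁻¹ • (T (f m) - (T (f n) - μ n • f n))
    have hu : u ∈ V n := Submodule.smul_mem _ _
      (Submodule.sub_mem _ (hTV n _ (hVmono hmn (hfV m))) (hSV n _ (hfV n)))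
    have heq : T (f n) - T (f m) = μ n • (f n - u) := by
      rw [smul_sub, smul_inv_smul₀ hμn]; module
    rw [heq, norm_smul]
    exact (hμ n).trans (le_mul_of_one_le_right (norm_nonneg _) (hfy n u hu))
  obtain ⟨K, hK, hK'⟩ := hT.image_closedBall_subset_compact (‖c‖ + 1)
  obtain ⟨y, -, φ, hφ, hφy⟩ :=
    hK.tendsto_subseq (x := fun n => T (f n)) (fun n => hK' ⟨f n, by simp [hfn], rfl⟩)
  obtain ⟨N, hN⟩ := Metric.cauchySeq_iff'.mp hφy.cauchySeq δ hδ
  have hlt := hN (N + 1) N.le_succ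
  rw [dist_eq_norm] at hlt
  exact hlt.not_ge (hfar (hφ N.lt_succ_self))

namespace IsResolventAt

variable {E : Type*} [NormedAddCommGroup E] [InnerProductSpace ℂ E]
  {H : E →ₗ.[ℂ] E} {z l : ℂ} {R : E →L[ℂ] E}

/-- An eigenvector of `H` is an eigenvector of its resolvent, at the transformed eigenvalue. -/
theorem hasEigenvector_of_apply_eq_smul (hR : IsResolventAt H z R) {ψ : H.domain}
    (hψ : (ψ : E) ≠ 0) (h : H ψ = l • (ψ : E)) :
    l ≠ z ∧ Module.End.HasEigenvector (R : Module.End ℂ E) (l - z)⁻¹ (ψ : E) := by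
  have hs : (l - z) • R (ψ : E) = ψ := by
    rw [← map_smul, sub_smul, ← h]
    exact hR.1 ψ
  have hlz : l - z ≠ 0 := by
    intro h0
    rw [h0, zero_smul] at hs
    exact hψ hs.symm
  refine ⟨sub_ne_zero.mp hlz, Module.End.hasEigenvector_iff.mpr
    ⟨Module.End.mem_eigenspace_iff.mpr ?_, hψ⟩⟩
  rw [eq_inv_smul_iff₀ hlz]
  exact hs

/-- An eigenvector of the resolvent is an eigenvector of `H`. -/
theorem exists_apply_eq_smul (hR : IsResolventAt H z R) (hlz : l ≠ z) {ψ : E}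
    (h : R ψ = (l - z)⁻¹ • ψ) : ∃ hψ : ψ ∈ H.domain, H ⟨ψ, hψ⟩ = l • ψ := by
  have hRψ : R ((l - z) • ψ) = ψ := by
    rw [map_smul, h, smul_inv_smul₀ (sub_ne_zero.mpr hlz)]
  have hmem := hR.2 ((l - z) • ψ)
  rw [hRψ] at hmem
  obtain ⟨hψ, heq⟩ := hmem
  refine ⟨hψ, ?_⟩
  rw [sub_eq_iff_eq_add.mp heq]
  module

/-- If `(l - z)⁻¹` is in the resolvent set of the resolvent at `z`, then `H` has a resolvent
at `l`. -/
theorem exists_of_mem_resolventSet (hR : IsResolventAt H z R) (hlz : l ≠ z)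
    (h : (l - z)⁻¹ ∈ resolventSet ℂ R) : ∃ R' : E →L[ℂ] E, IsResolventAt H l R' := by
  have hlz' : l - z ≠ 0 := sub_ne_zero.mpr hlz
  obtain ⟨u, hu⟩ := spectrum.mem_resolventSet_iff.mp h
  have hu_apply (φ : E) : (u : E →L[ℂ] E) φ = (l - z)⁻¹ • φ - R φ := by
    rw [hu, Algebra.algebraMap_eq_smul_one]; rfl
  let S : E →L[ℂ] E := ↑u⁻¹
  have hSu (φ : E) : S ((u : E →L[ℂ] E) φ) = φ := congrArg (fun A => A φ) u.inv_mul
  have huS (φ : E) : (u : E →L[ℂ] E) (S φ) = φ := congrArg (fun A => A φ) u.mul_inv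
  refine ⟨(l - z)⁻¹ • (R ∘L S), fun ψ => ?_, fun φ => ?_⟩
  · have hψ := hR.1 ψ
    have key : H ψ - l • (ψ : E) = (l - z) • (u : E →L[ℂ] E) (H ψ - z • (ψ : E)) := by
      rw [hu_apply, hψ, smul_sub, smul_inv_smul₀ hlz']
      module
    change (l - z)⁻¹ • R (S (H ψ - l • (ψ : E))) = ψ
    rw [key, map_smul, hSu, map_smul, hψ, inv_smul_smul₀ hlz']
  · have hval : ((l - z)⁻¹ • (R ∘L S)) φ = R ((l - z)⁻¹ • S φ) := by
      rw [map_smul]; rfl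
    rw [hval]
    obtain ⟨hmem, heq⟩ := hR.2 ((l - z)⁻¹ • S φ)
    refine ⟨hmem, ?_⟩
    have hφ := huS φ
    rw [hu_apply] at hφ
    have hRS : (l - z) • R ((l - z)⁻¹ • S φ) = R (S φ) := by
      rw [map_smul, smul_inv_smul₀ hlz']
    calc _ = (l - z)⁻¹ • S φ - (l - z) • R ((l - z)⁻¹ • S φ) := by
          rw [sub_eq_iff_eq_add.mp heq]; module
      _ = φ := by rw [hRS, hφ]

end IsResolventAt

/-- a closed densely defined operator `H` on `L²(ℝ)` whose domain is invariant
under translations and which satisfies `T_c H T_{-c} = H - ic` for all real `c`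
(equivalently `H(T_c ψ) = T_c(Hψ) + ic T_c ψ` on the domain), and which has compact
resolvent, has empty spectrum. -/
theorem translation_covariant_compact_resolvent_empty_spectrum
    (H : Lp ℂ 2 (volume : Measure ℝ) →ₗ.[ℂ] Lp ℂ 2 (volume : Measure ℝ))
    (hcl : H.IsClosed)
    (hdense : Dense (H.domain : Set (Lp ℂ 2 (volume : Measure ℝ))))
    (hdominv : ∀ c : ℝ, ∀ ψ, ψ ∈ H.domain → translationLp c ψ ∈ H.domain)
    (hcov : ∀ c : ℝ, ∀ ψ : H.domain,
      H ⟨translationLp c (ψ : Lp ℂ 2 (volume : Measure ℝ)),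
          hdominv c (ψ : Lp ℂ 2 (volume : Measure ℝ)) ψ.2⟩ =
        translationLp c (H ψ)
          + (Complex.I * (c : ℂ)) • translationLp c (ψ : Lp ℂ 2 (volume : Measure ℝ)))
    (hcompact : ∃ z : ℂ, ∃ R : Lp ℂ 2 (volume : Measure ℝ) →L[ℂ] Lp ℂ 2 (volume : Measure ℝ),
      IsResolventAt H z R ∧ IsCompactOperator R) :
    pmapSpectrum H = ∅ := by
  obtain ⟨z, R, hR, hRc⟩ := hcompact
  refine Set.eq_empty_of_forall_notMem fun l hl => hl ?_
  rcases eq_or_ne l z with rfl | hlz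
  · exact ⟨R, hR⟩
  refine hR.exists_of_mem_resolventSet hlz ((hRc.hasEigenvalue_or_mem_resolventSet
    (inv_ne_zero (sub_ne_zero.mpr hlz))).resolve_left fun heig => ?_)
  obtain ⟨ψ, hψ⟩ := heig.exists_hasEigenvector
  obtain ⟨hdom, hHψ⟩ := hR.exists_apply_eq_smul hlz hψ.apply_eq_smul
  have heigc (c : ℝ) : l + Complex.I * c ≠ z ∧ Module.End.HasEigenvector
      (R : Module.End ℂ (Lp ℂ 2 (volume : Measure ℝ))) (l + Complex.I * c - z)⁻¹
      (translationLp c ψ) := by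
    refine hR.hasEigenvector_of_apply_eq_smul (ψ := ⟨translationLp c ψ, hdominv c ψ hdom⟩) ?_ ?_
    · exact fun h => hψ.2 ((map_eq_zero_iff _ (translationLp c).injective).mp h)
    · rw [hcov c ⟨ψ, hdom⟩, hHψ, map_smul, add_smul]
  let c (n : ℕ) : ℝ := 1 / ((n : ℝ) + 1)
  have hc (n : ℕ) : ‖l + Complex.I * c n - z‖ ≤ ‖l - z‖ + 1 := by
    have hcn : ‖Complex.I * (c n : ℂ)‖ ≤ 1 := by
      rw [norm_mul, Complex.norm_I, one_mul, Complex.norm_real, Real.norm_eq_abs,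
        abs_of_nonneg (by positivity)]
      exact (div_le_one (by positivity)).mpr (by simp)
    calc ‖l + Complex.I * c n - z‖ = ‖(l - z) + Complex.I * c n‖ := by congr 1; ring
      _ ≤ ‖l - z‖ + 1 := (norm_add_le _ _).trans (by gcongr)
  refine hRc.not_injective_of_hasEigenvalue_of_le_norm
    (μ := fun n => (l + Complex.I * c n - z)⁻¹) (δ := (‖l - z‖ + 1)⁻¹)
    (fun n => Module.End.hasEigenvalue_of_hasEigenvector (heigc (c n)).2)
    (by positivity) (fun n => ?_) (fun m n hmn => ?_)
  · rw [norm_inv]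
    exact inv_anti₀ (norm_pos_iff.mpr (sub_ne_zero.mpr (heigc (c n)).1)) (hc n)
  · have hcmn : c m = c n := by simpa using hmn
    simpa [c] using hcmn
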